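/- arXiv:2503.06555 — 3 statements merged into one kernel-verified Lean document; each statement's English description precedes it below -/
import Mathlib

section
/- Let X be a finite-dimensional real inner product space, let l > 0 be a real number, and let P : X → X be a continuous map such that ⟨P v, v⟩ > 0 for every v ∈ X with ‖v‖ = l. Then there exists v ∈ X with ‖v‖ ≤ l and P v = 0. -/
open RealInnerProductSpace

open Set Metric MeasureTheory Filter Topology
open scoped NNReal

/-- A Lipschitz map on a closed ball that vanishes on the bounding sphere extends by zero to a
Lipschitz map with the same constant. -/
theorem LipschitzOnWith.indicator_closedBall {E F : Type*} [NormedAddCommGroup E] [NormedSpace ℝ E]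
    [NormedAddCommGroup F] {g : E → F} {K : ℝ≥0} {l : ℝ}
    (hg : LipschitzOnWith K g (closedBall 0 l)) (hzero : ∀ v, ‖v‖ = l → g v = 0) :
    LipschitzWith K ((closedBall 0 l).indicator g) := by
  have key : ∀ x ∈ closedBall (0 : E) l, ∀ y ∉ closedBall (0 : E) l,
      ‖g x‖ ≤ K * dist x y := by
    intro x hx y hy
    obtain ⟨z, hz, hzl⟩ : l ∈ norm '' segment ℝ x y := by
      refine (convex_segment x y).isPreconnected.intermediate_value (left_mem_segment ℝ x y)
        (right_mem_segment ℝ x y) continuous_norm.continuousOn ⟨by simpa using hx, ?_⟩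
      simpa using (not_le.1 fun h => hy (by simpa using h)).le
    have h := hg.dist_le_mul x hx z (by simp [hzl])
    rw [hzero z hzl, dist_zero_right] at h
    refine h.trans (mul_le_mul_of_nonneg_left ?_ K.2)
    linarith [dist_add_dist_of_mem_segment hz, dist_nonneg (x := z) (y := y)]
  refine LipschitzWith.of_dist_le_mul fun x y => ?_
  by_cases hx : x ∈ closedBall (0 : E) l <;> by_cases hy : y ∈ closedBall (0 : E) l
  · simpa [hx, hy, -mem_closedBall] using hg.dist_le_mul x hx y hy
  · simpa [hx, hy, -mem_closedBall] using key x hx y hy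
  · simpa [hx, hy, -mem_closedBall, dist_comm x y] using key y hy x hx
  · simp only [indicator_of_notMem hx, indicator_of_notMem hy, dist_self]
    positivity

/-- A perturbation of the identity by a contraction is bijective. -/
theorem ContractingWith.bijective_id_add {E : Type*} [NormedAddCommGroup E] [CompleteSpace E]
    {g : E → E} {K : ℝ≥0} (hg : ContractingWith K g) :
    Function.Bijective fun v => v + g v := by
  have hcontr (y : E) : ContractingWith K fun v => y - g v :=
    ⟨hg.1, LipschitzWith.of_dist_le_mul fun a b => by
      rw [dist_sub_left]
      exact hg.2.dist_le_mul a b⟩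
  constructor
  · intro a b hab
    have hab' : a + g a = b + g b := hab
    have ha : Function.IsFixedPt (fun v => (a + g a) - g v) a := add_sub_cancel_right a (g a)
    have hb : Function.IsFixedPt (fun v => (a + g a) - g v) b := by
      simp [Function.IsFixedPt, hab']
    exact (hcontr _).fixedPoint_unique' ha hb
  · intro y
    refine ⟨ContractingWith.fixedPoint _ (hcontr y), ?_⟩
    have h : y - g _ = _ := (hcontr y).fixedPoint_isFixedPt
    exact (sub_eq_iff_eq_add.1 h).symm

/-- A bijection which is the identity off `s` maps `s` onto itself. -/
theorem Function.Bijective.image_eq_of_eqOn_compl {α : Type*} {f : α → α} {s : Set α}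
    (hf : Function.Bijective f) (h : ∀ x ∉ s, f x = x) : f '' s = s := by
  have hc : f '' sᶜ = sᶜ := by
    simpa using (show EqOn f id sᶜ from h).image_eq
  rw [← compl_inj_iff, ← image_compl_eq hf, hc]

/-- Lagrange interpolation of `t ↦ det (1 + t • A)` at `t = 1`. -/
theorem ContinuousLinearMap.det_one_add_eq_sum_lagrange {E : Type*} [NormedAddCommGroup E]
    [NormedSpace ℝ E] [FiniteDimensional ℝ E] {ι : Type*} [DecidableEq ι] {s : Finset ι}
    {t : ι → ℝ} (ht : InjOn t s) (hs : Module.finrank ℝ E < s.card) (A : E →L[ℝ] E) :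
    (1 + A).det = ∑ i ∈ s, (Lagrange.basis s t i).eval 1 * (1 + t i • A).det := by
  let b := Module.finBasis ℝ E
  let M := LinearMap.toMatrix b b A
  let p : Polynomial ℝ := ((Polynomial.X : Polynomial ℝ) • M.map Polynomial.C +
    (1 : Matrix _ _ ℝ).map Polynomial.C).det
  have hp (r : ℝ) : p.eval r = (1 + r • A).det := by
    have h : (Polynomial.evalRingHom r).mapMatrix ((Polynomial.X : Polynomial ℝ) •
        M.map Polynomial.C + (1 : Matrix _ _ ℝ).map Polynomial.C) =
        LinearMap.toMatrix b b ((1 + r • A : E →L[ℝ] E) : E →ₗ[ℝ] E) := by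
      rw [ContinuousLinearMap.toLinearMap_add, ContinuousLinearMap.toLinearMap_smul,
        ContinuousLinearMap.toLinearMap_one, map_add (LinearMap.toMatrix b b),
        map_smul (LinearMap.toMatrix b b), LinearMap.toMatrix_one]
      ext i j
      by_cases hij : i = j <;> simp [hij, M] <;> ring
    rw [ContinuousLinearMap.det, ← LinearMap.det_toMatrix b, ← h, ← RingHom.map_det]
    rfl
  have hdeg : p.degree < s.card := by
    refine Polynomial.degree_le_natDegree.trans_lt ?_
    have := Polynomial.natDegree_det_X_add_C_le M 1
    rw [Fintype.card_fin] at this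
    exact_mod_cast this.trans_lt hs
  have h := congrArg (Polynomial.eval 1) (Lagrange.eq_interpolate ht hdeg)
  rw [hp, one_smul, Lagrange.interpolate_apply, Polynomial.eval_finsetSum] at h
  rw [h]
  refine Finset.sum_congr rfl fun i _ => ?_
  rw [Polynomial.eval_mul, Polynomial.eval_C, hp, mul_comm]

/-- The derivative of a map of locally constant norm is singular wherever the map is nonzero. -/
theorem HasFDerivAt.det_eq_zero_of_norm_eq {E : Type*} [NormedAddCommGroup E]
    [InnerProductSpace ℝ E] [FiniteDimensional ℝ E] {r : E → E} {r' : E →L[ℝ] E} {v : E} {l : ℝ}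
    (hr : HasFDerivAt r r' v) (hnorm : ∀ᶠ w in 𝓝 v, ‖r w‖ = l) (hv : r v ≠ 0) : r'.det = 0 := by
  by_contra hdet
  have hconst : HasFDerivAt (fun w => ‖r w‖ ^ 2) (0 : E →L[ℝ] ℝ) v :=
    (hasFDerivAt_const (l ^ 2) v).congr_of_eventuallyEq
      (hnorm.mono fun w hw => by simp [hw])
  have heq := hr.norm_sq.unique hconst
  obtain ⟨h, hh⟩ := (LinearMap.equivOfDetNeZero (r' : E →ₗ[ℝ] E) hdet).surjective (r v)
  have hh' : r' h = r v := hh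
  have := DFunLike.congr_fun heq h
  simp [hh'] at this
  exact hv this

/-- If `g` is Lipschitz on a closed ball, vanishes on its boundary and `t` is small, then
`v ↦ v + t • g v` preserves the volume of the ball. -/
theorem integral_det_one_add_smul_eq_volume_closedBall {E : Type*} [NormedAddCommGroup E]
    [NormedSpace ℝ E] [FiniteDimensional ℝ E] [MeasurableSpace E] [BorelSpace E]
    (μ : Measure E) [μ.IsAddHaarMeasure] {g : E → E} {g' : E → E →L[ℝ] E} {K : ℝ≥0} {l t : ℝ}
    (hg : LipschitzOnWith K g (closedBall 0 l)) (hzero : ∀ v, ‖v‖ = l → g v = 0)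
    (hg' : ∀ v ∈ closedBall (0 : E) l, HasFDerivAt g (g' v) v) (ht : ‖t‖₊ * K < 1)
    (hdet : ∀ v ∈ closedBall (0 : E) l, 0 ≤ (1 + t • g' v).det) :
    ∫ v in closedBall (0 : E) l, (1 + t • g' v).det ∂μ = μ.real (closedBall 0 l) := by
  let s := closedBall (0 : E) l
  have hcontr : ContractingWith (‖t‖₊ * K) fun v => t • s.indicator g v :=
    ⟨ht, (lipschitzWith_smul t).comp (hg.indicator_closedBall hzero)⟩
  have hbij := hcontr.bijective_id_add
  have heq : EqOn (fun v => v + t • s.indicator g v) (fun v => v + t • g v) s :=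
    fun v hv => by simp only [indicator_of_mem hv]
  have himage : (fun v => v + t • g v) '' s = s := by
    rw [← heq.image_eq]
    exact hbij.image_eq_of_eqOn_compl fun v hv => by simp only [indicator_of_notMem hv]; simp
  have hinj : InjOn (fun v => v + t • g v) s := heq.injOn_iff.1 hbij.injective.injOn
  have hderiv : ∀ v ∈ s, HasFDerivWithinAt (fun v => v + t • g v) (1 + t • g' v) s v :=
    fun v hv => ((hasFDerivAt_id v).add ((hg' v hv).const_smul t)).hasFDerivWithinAt
  have h := integral_image_eq_integral_abs_det_fderiv_smul μ
    (isClosed_closedBall (x := (0 : E)) (ε := l)).measurableSet hderiv hinj fun _ => (1 : ℝ)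
  rw [himage] at h
  simp only [smul_eq_mul, mul_one, integral_const, measureReal_restrict_apply_univ] at h
  rw [h]
  exact setIntegral_congr_fun isClosed_closedBall.measurableSet
    fun v hv => (abs_of_nonneg (hdet v hv)).symm

/-- There is no continuously differentiable retraction of a closed ball onto its sphere. -/
theorem not_contDiffOn_retraction_sphere {E : Type*} [NormedAddCommGroup E]
    [InnerProductSpace ℝ E] [FiniteDimensional ℝ E] {l : ℝ} (hl : 0 < l) {U : Set E}
    (hU : IsOpen U) (hball : closedBall 0 l ⊆ U) {r : E → E} (hr : ContDiffOn ℝ 1 r U)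
    (hnorm : ∀ v ∈ U, ‖r v‖ = l) (hfix : ∀ v, ‖v‖ = l → r v = v) : False := by
  borelize E
  let μ : Measure E := volume
  let s := closedBall (0 : E) l
  let g : E → E := fun v => r v - v
  have hs : IsCompact s := isCompact_closedBall 0 l
  have hg : ContDiffOn ℝ 1 g U := hr.sub contDiffOn_id
  have hg' : ∀ v ∈ s, HasFDerivAt g (fderiv ℝ g v) v := fun v hv =>
    ((hg.differentiableOn one_ne_zero).differentiableAt (hU.mem_nhds (hball hv))).hasFDerivAt
  have hcont : ContinuousOn (fderiv ℝ g) s :=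
    (hg.continuousOn_fderiv_of_isOpen hU le_rfl).mono hball
  obtain ⟨C, hC⟩ := hs.exists_bound_of_continuousOn hcont
  have hbound : ∀ v ∈ s, ‖fderiv ℝ g v‖₊ ≤ C.toNNReal := fun v hv => by
    rw [← NNReal.coe_le_coe]
    exact (hC v hv).trans (Real.le_coe_toNNReal C)
  have hlip : LipschitzOnWith C.toNNReal g s :=
    (convex_closedBall 0 l).lipschitzOnWith_of_nnnorm_hasFDerivWithin_le
      (fun v hv => (hg' v hv).hasFDerivWithinAt) hbound
  have hzero : ∀ v, ‖v‖ = l → g v = 0 := fun v hv => by simp [g, hfix v hv]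
  obtain ⟨ε, hε, hpos⟩ : ∃ ε > 0, ∀ A : E →L[ℝ] E, dist A 1 < ε → 0 < A.det := by
    refine Metric.eventually_nhds_iff.1 <|
      ContinuousLinearMap.continuous_det.continuousAt.eventually_const_lt ?_
    simp [ContinuousLinearMap.det]
  obtain ⟨δ, hδ, hδC⟩ : ∃ δ > 0, δ * (C.toNNReal : ℝ) < min 1 ε := by
    refine ⟨min 1 ε / (C.toNNReal + 1), by positivity, ?_⟩
    rw [div_mul_eq_mul_div, div_lt_iff₀ (by positivity)]
    have : 0 < min 1 ε := by positivity
    nlinarith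
  have hvol (t : ℝ) (ht : |t| ≤ δ) :
      ∫ v in s, (1 + t • fderiv ℝ g v).det ∂μ = μ.real s := by
    have htC : |t| * (C.toNNReal : ℝ) < min 1 ε :=
      (mul_le_mul_of_nonneg_right ht C.toNNReal.2).trans_lt hδC
    refine integral_det_one_add_smul_eq_volume_closedBall μ hlip hzero hg' ?_ fun v hv => ?_
    · rw [← NNReal.coe_lt_coe]
      simpa using htC.trans_le (min_le_left 1 ε)
    · refine (hpos _ ?_).le
      rw [dist_eq_norm, add_sub_cancel_left, norm_smul]
      have hv' : ‖fderiv ℝ g v‖ ≤ C.toNNReal := hbound v hv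
      exact ((mul_le_mul_of_nonneg_left hv' (abs_nonneg t)).trans_lt htC).trans_le
        (min_le_right 1 ε)
  let N := Finset.range (Module.finrank ℝ E + 1)
  let t : ℕ → ℝ := fun i => δ / (i + 1)
  have ht : InjOn t N := fun i _ j _ hij => by
    have h : δ / ((i : ℝ) + 1) = δ / (j + 1) := hij
    rw [div_eq_div_iff (by positivity) (by positivity), mul_right_inj' hδ.ne'] at h
    exact_mod_cast (add_right_cancel h).symm
  have htδ (i : ℕ) : |t i| ≤ δ := by
    rw [abs_of_pos (by positivity)]
    exact div_le_self hδ.le (by simp)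
  have hsingular : ∫ v in s, (1 + fderiv ℝ g v).det ∂μ = 0 := by
    refine setIntegral_eq_zero_of_forall_eq_zero fun v hv => ?_
    have hrv : HasFDerivAt r (1 + fderiv ℝ g v) v :=
      ((hasFDerivAt_id v).add (hg' v hv)).congr_of_eventuallyEq
        (Eventually.of_forall fun w => by simp [g])
    refine hrv.det_eq_zero_of_norm_eq
      (mem_of_superset (hU.mem_nhds (hball hv)) hnorm) ?_
    rw [← norm_pos_iff, hnorm v (hball hv)]
    exact hl
  have hint (i : ℕ) : IntegrableOn (fun v => (1 + t i • fderiv ℝ g v).det) s μ :=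
    (ContinuousLinearMap.continuous_det.comp_continuousOn
      (continuousOn_const.add (hcont.const_smul (t i)))).integrableOn_compact hs
  have hsum : ∑ i ∈ N, (Lagrange.basis N t i).eval 1 = 1 := by
    rw [← Polynomial.eval_finsetSum, Lagrange.sum_basis ht (by simp [N]), Polynomial.eval_one]
  have hdet (v : E) := ContinuousLinearMap.det_one_add_eq_sum_lagrange ht
    (show Module.finrank ℝ E < N.card by simp [N]) (fderiv ℝ g v)
  have hvol_zero : μ.real s = 0 := by
    rw [← hsingular]
    simp_rw [hdet]
    rw [integral_finsetSum _ fun i _ => (hint i).const_mul _]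
    simp_rw [integral_const_mul, hvol _ (htδ _), ← Finset.sum_mul, hsum, one_mul]
  have hvol_pos : 0 < μ.real s :=
    ENNReal.toReal_pos (measure_closedBall_pos μ 0 hl).ne' hs.measure_lt_top.ne
  exact hvol_pos.ne' hvol_zero

/-- For continuous `Q`, the map `v ↦ v + (l ^ 2 - ‖v‖ ^ 2) • Q v`, which fixes the sphere of
radius `l` pointwise, has a zero in the closed ball of radius `l`. -/
theorem exists_add_smul_eq_zero {E : Type*} [NormedAddCommGroup E] [InnerProductSpace ℝ E]
    [FiniteDimensional ℝ E] {l : ℝ} (hl : 0 < l) {Q : E → E} (hQ : Continuous Q) :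
    ∃ v, ‖v‖ ≤ l ∧ v + (l ^ 2 - ‖v‖ ^ 2) • Q v = 0 := by
  by_contra! hne
  have hs : IsCompact (closedBall (0 : E) l) := isCompact_closedBall 0 l
  have hcont : Continuous fun v => v + (l ^ 2 - ‖v‖ ^ 2) • Q v := by fun_prop
  obtain ⟨w, hw, hmin⟩ := hs.exists_isMinOn ⟨0, by simp [hl.le]⟩ hcont.norm.continuousOn
  have hwpos : 0 < ‖w + (l ^ 2 - ‖w‖ ^ 2) • Q w‖ := norm_pos_iff.2 (hne w (by simpa using hw))
  set m := ‖w + (l ^ 2 - ‖w‖ ^ 2) • Q w‖ with hm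
  obtain ⟨R, hR, hRQ, -⟩ := hQ.exists_contDiff_approx 1 (ε := fun _ => m / l ^ 2)
    continuous_const fun _ => by positivity
  let F : E → E := fun v => v + (l ^ 2 - ‖v‖ ^ 2) • R v
  have hF : ContDiff ℝ 1 F :=
    contDiff_id.add ((contDiff_const.sub (contDiff_norm_sq ℝ)).smul (by exact_mod_cast hR))
  have hFne : ∀ v ∈ closedBall (0 : E) l, F v ≠ 0 := by
    intro v hv h
    have hvl : ‖v‖ ≤ l := by simpa using hv
    have hsq : ‖v‖ ^ 2 ≤ l ^ 2 := pow_le_pow_left₀ (norm_nonneg v) hvl 2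
    have hmv : m ≤ ‖v + (l ^ 2 - ‖v‖ ^ 2) • Q v‖ := hmin hv
    have heq : v + (l ^ 2 - ‖v‖ ^ 2) • Q v = (l ^ 2 - ‖v‖ ^ 2) • (Q v - R v) := by
      rw [← sub_zero (v + _), ← h, smul_sub]
      simp [F]
    rw [heq, norm_smul, Real.norm_of_nonneg (sub_nonneg.2 hsq), ← dist_eq_norm, dist_comm] at hmv
    have h1 := hRQ v
    rw [lt_div_iff₀ (by positivity)] at h1
    nlinarith [mul_nonneg (sq_nonneg ‖v‖) (dist_nonneg (x := R v) (y := Q v))]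
  refine not_contDiffOn_retraction_sphere hl (U := {v | F v ≠ 0})
    (isOpen_ne_fun hF.continuous continuous_const) hFne
    (r := fun v => (l * ‖F v‖⁻¹) • F v) ?_ ?_ ?_
  · intro v hv
    have h := hF.contDiffAt (x := v)
    exact ((contDiffAt_const.mul ((h.norm ℝ hv).inv (norm_ne_zero_iff.2 hv))).smul
      h).contDiffWithinAt
  · intro v hv
    have : ‖F v‖ ≠ 0 := norm_ne_zero_iff.2 hv
    simp [norm_smul, this, abs_of_pos hl]
  · intro v hv
    simp [F, hv, hl.ne']

/-- Extension of the Brouwer fixed point theorem (Temam, Lemma 1.4). -/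
theorem brouwer_extension {X : Type*} [NormedAddCommGroup X] [InnerProductSpace ℝ X]
    [FiniteDimensional ℝ X] (l : ℝ) (hl : 0 < l) (P : X → X) (hP : Continuous P)
    (hpos : ∀ v : X, ‖v‖ = l → 0 < ⟪P v, v⟫) :
    ∃ v : X, ‖v‖ ≤ l ∧ P v = 0 := by
  by_contra! hne
  have hs : IsCompact (closedBall (0 : X) l) := isCompact_closedBall 0 l
  obtain ⟨w, hw, hmin⟩ := hs.exists_isMinOn ⟨0, by simp [hl.le]⟩ hP.norm.continuousOn
  have hw_pos : 0 < ‖P w‖ := norm_pos_iff.2 (hne w (by simpa using hw))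
  obtain ⟨c, hc, hcK⟩ : ∃ c > 0, ∀ v, ‖v‖ ≤ l → ⟪P v, v⟫ ≤ 0 → c ≤ l ^ 2 - ‖v‖ ^ 2 := by
    have hK : IsCompact (closedBall (0 : X) l ∩ {v | ⟪P v, v⟫ ≤ 0}) :=
      hs.inter_right (isClosed_le (by fun_prop) continuous_const)
    obtain ⟨c, hc, h⟩ := hK.exists_forall_le' (f := fun v => l ^ 2 - ‖v‖ ^ 2) (a := 0)
      (by fun_prop) fun v hv => by
        have hvl : ‖v‖ < l := lt_of_le_of_ne (by simpa using hv.1)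
          fun h => (hpos v h).not_ge hv.2
        exact sub_pos.2 (pow_lt_pow_left₀ hvl (norm_nonneg v) two_ne_zero)
    exact ⟨c, hc, fun v hv hv' => h v ⟨by simpa using hv, hv'⟩⟩
  set M := (l + 1) / (c * ‖P w‖) with hM
  have hMpos : 0 < M := by positivity
  obtain ⟨v, hvl, hv⟩ := exists_add_smul_eq_zero hl (hP.const_smul M)
  have hd : 0 ≤ l ^ 2 - ‖v‖ ^ 2 := sub_nonneg.2 (pow_le_pow_left₀ (norm_nonneg v) hvl 2)
  have hv' : v = -(((l ^ 2 - ‖v‖ ^ 2) * M) • P v) := by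
    rw [mul_smul]
    exact eq_neg_of_add_eq_zero_left hv
  have hinner : ⟪P v, v⟫ ≤ 0 := by
    rw [hv', inner_neg_right, inner_smul_right, ← hv', real_inner_self_eq_norm_sq]
    exact neg_nonpos.2 (by positivity)
  have hle : c * M * ‖P w‖ ≤ l := by
    calc c * M * ‖P w‖ ≤ (l ^ 2 - ‖v‖ ^ 2) * M * ‖P v‖ := by
          gcongr
          · exact hcK v hvl hinner
          · exact hmin (by simpa using hvl)
      _ = ‖v‖ := by
          conv_rhs => rw [hv']
          rw [norm_neg, norm_smul, Real.norm_of_nonneg (by positivity)]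
      _ ≤ l := hvl
  have : c * M * ‖P w‖ = l + 1 := by
    rw [hM]
    field_simp
  linarith
end

section
/- Let V be a finite-dimensional real inner product space with norm ‖·‖, and let a : V × V × V → ℝ be such that for every w ∈ V the map (u,v) ↦ a(w;u,v) is bilinear. Assume: (i) a(w;v,v) ≥ ‖v‖² for all w, v ∈ V; (ii) there are constants M ≥ 0 and L ≥ 0 with |a(w;u,v)| ≤ M‖u‖‖v‖ and |a(w;u,v) − a(w′;u,v)| ≤ L‖w − w′‖‖u‖‖v‖ for all w, w′, u, v ∈ V. Let F : V → ℝ be a continuous linear functional. Then there exists u ∈ V such that a(u;u,v) = F(v) for all v ∈ V, and every such u satisfies ‖u‖ ≤ ‖F‖ (the operator norm of F). -/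
open MeasureTheory Set Topology Module

open scoped NNReal

section Jacobian

variable {V : Type*} [NormedAddCommGroup V] [InnerProductSpace ℝ V] [FiniteDimensional ℝ V]

/-- The map `t ↦ det (1 + t T)` is a polynomial of degree at most the dimension of the space. -/
lemma exists_polynomial_eval_eq_det_one_add_smul (T : V →L[ℝ] V) :
    ∃ p : Polynomial ℝ, p.natDegree ≤ finrank ℝ V ∧
      ∀ t : ℝ, p.eval t = (ContinuousLinearMap.id ℝ V + t • T).det := by
  let b := finBasis ℝ V
  let A := LinearMap.toMatrix b b (T : V →ₗ[ℝ] V)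
  refine ⟨((Polynomial.X : Polynomial ℝ) • A.map Polynomial.C +
    (1 : Matrix _ _ ℝ).map Polynomial.C).det, ?_, fun t => ?_⟩
  · simpa using Polynomial.natDegree_det_X_add_C_le A 1
  · have h : ((ContinuousLinearMap.id ℝ V + t • T : V →L[ℝ] V) : V →ₗ[ℝ] V) =
        LinearMap.id + t • (T : V →ₗ[ℝ] V) := rfl
    rw [ContinuousLinearMap.det, h, ← LinearMap.det_toMatrix b, map_add, map_smul,
      LinearMap.toMatrix_id, ← Polynomial.coe_evalRingHom, RingHom.map_det]
    congr 1
    ext i j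
    rcases eq_or_ne i j with rfl | hij
    · simp [A]
      ring
    · simp [A, hij]
      ring

/-- A perturbation `x ↦ x + t g x` of the identity by a small multiple of a Lipschitz map is
bijective. -/
lemma bijective_add_smul_of_lipschitzWith {g : V → V} {C : ℝ≥0} (hg : LipschitzWith C g)
    {t : ℝ} (ht : 0 ≤ t) (htC : t * C < 1) : Function.Bijective fun x => x + t • g x := by
  have h : ApproximatesLinearOn (fun x => x + t • g x)
      ((ContinuousLinearEquiv.refl ℝ V : V ≃L[ℝ] V) : V →L[ℝ] V) univ (t.toNNReal * C) := by
    intro x _ y _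
    have h1 : x + t • g x - (y + t • g y) -
        ((ContinuousLinearEquiv.refl ℝ V : V ≃L[ℝ] V) : V →L[ℝ] V) (x - y) =
          t • (g x - g y) := by
      simp only [ContinuousLinearEquiv.coe_coe, ContinuousLinearEquiv.refl_apply, smul_sub]
      abel
    rw [h1, norm_smul, Real.norm_of_nonneg ht, NNReal.coe_mul, Real.coe_toNNReal t ht, mul_assoc]
    exact mul_le_mul_of_nonneg_left (hg.norm_sub_le x y) ht
  have hc : Subsingleton V ∨ t.toNNReal * C <
      ‖((ContinuousLinearEquiv.refl ℝ V : V ≃L[ℝ] V).symm : V →L[ℝ] V)‖₊⁻¹ := by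
    rcases subsingleton_or_nontrivial V with hV | hV
    · exact Or.inl hV
    · right
      have h1 : ‖((ContinuousLinearEquiv.refl ℝ V : V ≃L[ℝ] V).symm : V →L[ℝ] V)‖₊ = 1 :=
        NNReal.eq (ContinuousLinearMap.norm_id (𝕜 := ℝ) (E := V))
      rw [h1, inv_one, ← NNReal.coe_lt_coe]
      simpa [Real.coe_toNNReal t ht] using htC
  refine ⟨?_, h.surjective hc⟩
  simpa [injOn_univ] using h.injOn hc

variable [MeasurableSpace V] [BorelSpace V]

/-- If `g` is Lipschitz and vanishes outside a ball, then for small `t ≥ 0` the Jacobian of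
`x ↦ x + t g x` integrates over the ball to the volume of the ball. -/
lemma exists_forall_integral_det_one_add_smul_fderiv {g : V → V} {C : ℝ≥0}
    (hg : LipschitzWith C g) {R : ℝ} (hR : ∀ x, R ≤ ‖x‖ → g x = 0) :
    ∃ ε > 0, ∀ t : ℝ, 0 ≤ t → t < ε →
      IntegrableOn (fun x => (ContinuousLinearMap.id ℝ V + t • fderiv ℝ g x).det)
        (Metric.ball 0 R) (Measure.hausdorffMeasure (finrank ℝ V)) ∧
      ∫ x in Metric.ball 0 R, (ContinuousLinearMap.id ℝ V + t • fderiv ℝ g x).det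
        ∂(Measure.hausdorffMeasure (finrank ℝ V)) =
        (Measure.hausdorffMeasure (finrank ℝ V) : Measure V).real (Metric.ball 0 R) := by
  set μ : Measure V := Measure.hausdorffMeasure (finrank ℝ V) with hμ
  obtain ⟨δ, hδ, hdet⟩ : ∃ δ > 0, ∀ A : V →L[ℝ] V, ‖A‖ < δ →
      0 < (ContinuousLinearMap.id ℝ V + A).det := by
    have hc : Continuous fun A : V →L[ℝ] V => (ContinuousLinearMap.id ℝ V + A).det :=
      ContinuousLinearMap.continuous_det.comp (continuous_const.add continuous_id)
    have h0 : (0 : ℝ) < (ContinuousLinearMap.id ℝ V + 0).det := by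
      simp [ContinuousLinearMap.det]
    obtain ⟨δ, hδ, h⟩ := Metric.eventually_nhds_iff.1 (hc.continuousAt.eventually_const_lt h0)
    exact ⟨δ, hδ, fun A hA => h (by simpa using hA)⟩
  refine ⟨min 1 δ / (C + 1), by positivity, fun t ht0 htε => ?_⟩
  have htC' : t * (C + 1) < min 1 δ := (lt_div_iff₀ (by positivity)).1 htε
  have htC : t * C < min 1 δ := by nlinarith
  set f : V → V := fun x => x + t • g x with hf
  have hbij : Function.Bijective f :=
    bijective_add_smul_of_lipschitzWith hg ht0 (htC.trans_le (min_le_left _ _))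
  have hfix : ∀ x, x ∉ Metric.ball (0 : V) R → f x = x := fun x hx => by
    have : R ≤ ‖x‖ := by simpa using hx
    simp [hf, hR x this]
  have himage : f '' Metric.ball 0 R = Metric.ball 0 R := by
    ext y
    constructor
    · rintro ⟨x, hx, rfl⟩
      by_contra hy
      exact hy ((hbij.1 (hfix _ hy)).symm ▸ hx)
    · intro hy
      obtain ⟨x, rfl⟩ := hbij.2 y
      refine ⟨x, ?_, rfl⟩
      by_contra hx
      exact hx (hfix x hx ▸ hy)
  have hfLip : ∃ K, LipschitzWith K f :=
    ⟨_, LipschitzWith.id.add ((lipschitzWith_smul t).comp hg)⟩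
  obtain ⟨K, hfLip⟩ := hfLip
  set D : Set V := {x | DifferentiableAt ℝ g x} with hD
  have hDmeas : MeasurableSet D := measurableSet_of_differentiableAt ℝ g
  have hDae : μ Dᶜ = 0 := hg.ae_differentiableAt
  set S : Set V := Metric.ball 0 R ∩ D with hS
  have hSmeas : MeasurableSet S := Metric.isOpen_ball.measurableSet.inter hDmeas
  have hnull : μ (f '' Dᶜ) = 0 := by
    have h := hfLip.hausdorffMeasure_image_le (d := finrank ℝ V) (by positivity) Dᶜ
    rw [← hμ, hDae, mul_zero] at h
    exact le_antisymm h bot_le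
  have hSball : S =ᵐ[μ] Metric.ball (0 : V) R :=
    inter_ae_eq_left_of_ae_eq_univ (ae_eq_univ.2 hDae)
  have hvol : f '' S =ᵐ[μ] Metric.ball (0 : V) R := by
    refine Filter.EventuallyLE.antisymm ?_ ?_
    · exact (himage ▸ image_mono inter_subset_left : f '' S ⊆ Metric.ball 0 R).eventuallyLE
    · refine ae_le_set.2 (measure_mono_null ?_ hnull)
      rintro y ⟨hy, hyS⟩
      rw [← himage] at hy
      obtain ⟨x, hx, rfl⟩ := hy
      exact ⟨x, fun hxD => hyS ⟨x, ⟨hx, hxD⟩, rfl⟩, rfl⟩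
  have hderiv : ∀ x ∈ S, HasFDerivWithinAt f
      (ContinuousLinearMap.id ℝ V + t • fderiv ℝ g x) S x := fun x hx =>
    ((hasFDerivAt_id x).add (hx.2.hasFDerivAt.const_smul t)).hasFDerivWithinAt
  have hpos : ∀ x, 0 < (ContinuousLinearMap.id ℝ V + t • fderiv ℝ g x).det := fun x => by
    refine hdet _ ?_
    rw [norm_smul, Real.norm_of_nonneg ht0]
    exact (mul_le_mul_of_nonneg_left (norm_fderiv_le_of_lipschitz ℝ hg) ht0).trans_lt
      (htC.trans_le (min_le_right _ _))
  have hint := integrableOn_image_iff_integrableOn_abs_det_fderiv_smul μ hSmeas hderiv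
    hbij.1.injOn (fun _ => (1 : ℝ))
  have heq := integral_image_eq_integral_abs_det_fderiv_smul μ hSmeas hderiv
    hbij.1.injOn (fun _ => (1 : ℝ))
  simp only [abs_of_pos (hpos _), smul_eq_mul, mul_one] at hint heq
  rw [integrableOn_congr_set_ae hvol, integrableOn_congr_set_ae hSball] at hint
  rw [setIntegral_congr_set hvol, setIntegral_congr_set hSball] at heq
  refine ⟨hint.1 (integrableOn_const Metric.isBounded_ball.measure_lt_top.ne), ?_⟩
  rw [← heq]
  simp

/-- If `g` is Lipschitz and vanishes outside a ball, then the Jacobian of `x ↦ x + g x` integrates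
over the ball to the volume of the ball. -/
lemma integral_det_one_add_fderiv {g : V → V} {C : ℝ≥0}
    (hg : LipschitzWith C g) {R : ℝ} (hR : ∀ x, R ≤ ‖x‖ → g x = 0) :
    ∫ x in Metric.ball 0 R, (ContinuousLinearMap.id ℝ V + fderiv ℝ g x).det
      ∂(Measure.hausdorffMeasure (finrank ℝ V)) =
      (Measure.hausdorffMeasure (finrank ℝ V) : Measure V).real (Metric.ball 0 R) := by
  obtain ⟨ε, hε, h⟩ := exists_forall_integral_det_one_add_smul_fderiv hg hR
  set n := finrank ℝ V
  let v : ℕ → ℝ := fun i => ε / (i + 2)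
  have hv : InjOn v (Finset.range (n + 1)) := by
    intro i _ j _ hij
    have h1 : (0 : ℝ) < i + 2 := by positivity
    have h2 : (0 : ℝ) < j + 2 := by positivity
    simp only [v] at hij
    rw [div_eq_div_iff h1.ne' h2.ne'] at hij
    exact_mod_cast (add_right_cancel (mul_left_cancel₀ hε.ne' hij)).symm
  have hvpos : ∀ i, 0 ≤ v i := fun i => by positivity
  have hvlt : ∀ i, v i < ε := fun i => by
    refine div_lt_self hε ?_
    have : (0 : ℝ) ≤ i := Nat.cast_nonneg i
    linarith
  have key : ∀ T : V →L[ℝ] V, (ContinuousLinearMap.id ℝ V + T).det =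
      ∑ i ∈ Finset.range (n + 1), (ContinuousLinearMap.id ℝ V + v i • T).det *
        (Lagrange.basis (Finset.range (n + 1)) v i).eval 1 := by
    intro T
    obtain ⟨p, hp, hpe⟩ := exists_polynomial_eval_eq_det_one_add_smul T
    have hdeg : p.degree < (Finset.range (n + 1)).card := by
      rw [Finset.card_range]
      exact Polynomial.degree_le_natDegree.trans_lt (by exact_mod_cast Nat.lt_succ_of_le hp)
    have h1 := congrArg (Polynomial.eval 1) (Lagrange.eq_interpolate hv hdeg)
    rw [Lagrange.interpolate_apply, Polynomial.eval_finsetSum] at h1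
    simpa [hpe] using h1
  rw [integral_congr_ae (Filter.Eventually.of_forall fun x => key (fderiv ℝ g x)),
    integral_finsetSum _ fun i _ => (h (v i) (hvpos i) (hvlt i)).1.mul_const _]
  simp_rw [integral_mul_const, (h _ (hvpos _) (hvlt _)).2, ← Finset.mul_sum,
    ← Polynomial.eval_finsetSum]
  rw [Lagrange.sum_basis hv (by simp)]
  simp

end Jacobian

section Zeros

variable {V : Type*} [NormedAddCommGroup V] [InnerProductSpace ℝ V]

/-- Normalizing two vectors, one of norm at least `δ`, increases distances by at most `2 / δ`. -/
lemma norm_inv_norm_smul_sub_le {δ : ℝ} (hδ : 0 < δ) {y z : V} (hy : δ ≤ ‖y‖) (hz : δ ≤ ‖z‖) :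
    ‖‖y‖⁻¹ • y - ‖z‖⁻¹ • z‖ ≤ 2 / δ * ‖y - z‖ := by
  have hy0 : 0 < ‖y‖ := hδ.trans_le hy
  have hz0 : 0 < ‖z‖ := hδ.trans_le hz
  have h1 : ‖y‖⁻¹ • y - ‖z‖⁻¹ • z =
      ‖y‖⁻¹ • ((y - z) + (‖z‖ - ‖y‖) • (‖z‖⁻¹ • z)) := by
    have : ‖y‖⁻¹ * (‖z‖ - ‖y‖) * ‖z‖⁻¹ = ‖y‖⁻¹ - ‖z‖⁻¹ := by
      field_simp
    rw [smul_add, smul_smul, smul_smul, this, smul_sub, sub_smul]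
    abel
  have h2 : ‖(‖z‖ - ‖y‖) • (‖z‖⁻¹ • z)‖ ≤ ‖y - z‖ := by
    rw [norm_smul, norm_smul, norm_inv, norm_norm, inv_mul_cancel₀ hz0.ne', mul_one,
      Real.norm_eq_abs, norm_sub_rev]
    exact abs_norm_sub_norm_le z y
  calc ‖‖y‖⁻¹ • y - ‖z‖⁻¹ • z‖
      = ‖y‖⁻¹ * ‖(y - z) + (‖z‖ - ‖y‖) • (‖z‖⁻¹ • z)‖ := by
        rw [h1, norm_smul, norm_inv, norm_norm]
    _ ≤ δ⁻¹ * (‖y - z‖ + ‖y - z‖) := by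
        gcongr
        exact (norm_add_le _ _).trans (by gcongr)
    _ = 2 / δ * ‖y - z‖ := by ring

/-- Pushing the ball of radius `R` radially onto its boundary sphere, and fixing all other points,
is Lipschitz away from the origin. -/
lemma norm_radial_sub_le {δ R : ℝ} (hδ : 0 < δ) (hR : 0 ≤ R) {y z : V} (hy : δ ≤ ‖y‖)
    (hz : δ ≤ ‖z‖) :
    ‖(y + max (R - ‖y‖) 0 • (‖y‖⁻¹ • y)) - (z + max (R - ‖z‖) 0 • (‖z‖⁻¹ • z))‖ ≤
      (2 + R * (2 / δ)) * ‖y - z‖ := by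
  have hz0 : 0 < ‖z‖ := hδ.trans_le hz
  have h1 : (y + max (R - ‖y‖) 0 • (‖y‖⁻¹ • y)) - (z + max (R - ‖z‖) 0 • (‖z‖⁻¹ • z)) =
      (y - z) + (max (R - ‖y‖) 0 • (‖y‖⁻¹ • y - ‖z‖⁻¹ • z) +
        (max (R - ‖y‖) 0 - max (R - ‖z‖) 0) • (‖z‖⁻¹ • z)) := by
    rw [smul_sub, sub_smul]
    abel
  have h2 : ‖max (R - ‖y‖) 0 • (‖y‖⁻¹ • y - ‖z‖⁻¹ • z)‖ ≤ R * (2 / δ * ‖y - z‖) := by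
    rw [norm_smul, Real.norm_of_nonneg (le_max_right _ _)]
    refine mul_le_mul (max_le (by linarith [norm_nonneg y]) hR)
      (norm_inv_norm_smul_sub_le hδ hy hz) (norm_nonneg _) hR
  have h3 : ‖(max (R - ‖y‖) 0 - max (R - ‖z‖) 0) • (‖z‖⁻¹ • z)‖ ≤ ‖y - z‖ := by
    rw [norm_smul, norm_smul, norm_inv, norm_norm, inv_mul_cancel₀ hz0.ne', mul_one,
      Real.norm_eq_abs]
    refine (abs_max_sub_max_le_abs _ _ _).trans ?_
    rw [show R - ‖y‖ - (R - ‖z‖) = ‖z‖ - ‖y‖ by ring, norm_sub_rev]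
    exact abs_norm_sub_norm_le z y
  rw [h1]
  linarith [norm_add_le (y - z) (max (R - ‖y‖) 0 • (‖y‖⁻¹ • y - ‖z‖⁻¹ • z) +
      (max (R - ‖y‖) 0 - max (R - ‖z‖) 0) • (‖z‖⁻¹ • z)),
    norm_add_le (max (R - ‖y‖) 0 • (‖y‖⁻¹ • y - ‖z‖⁻¹ • z))
      ((max (R - ‖y‖) 0 - max (R - ‖z‖) 0) • (‖z‖⁻¹ • z))]

variable [FiniteDimensional ℝ V]

/-- A Lipschitz map equal to the identity outside a ball cannot have constant positive norm on
that ball. -/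
lemma not_norm_eq_of_lipschitzWith {Q : V → V} {C : ℝ≥0} (hQ : LipschitzWith C Q) {R : ℝ}
    (hR : 0 < R) (hout : ∀ x, R ≤ ‖x‖ → Q x = x) :
    ¬ ∀ x, ‖x‖ ≤ R → ‖Q x‖ = R := by
  intro hin
  borelize V
  set μ : Measure V := Measure.hausdorffMeasure (finrank ℝ V) with hμ
  have hg : LipschitzWith (C + 1) fun x => Q x - x := hQ.sub LipschitzWith.id
  have hint := integral_det_one_add_fderiv hg (R := R) fun x hx => by simp [hout x hx]
  have hae : ∀ᵐ x ∂μ.restrict (Metric.ball 0 R),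
      (ContinuousLinearMap.id ℝ V + fderiv ℝ (fun x => Q x - x) x).det = 0 := by
    filter_upwards [ae_restrict_of_ae hQ.ae_differentiableAt,
      ae_restrict_mem Metric.isOpen_ball.measurableSet] with x hx hxR
    have h1 : ContinuousLinearMap.id ℝ V + fderiv ℝ (fun x => Q x - x) x = fderiv ℝ Q x := by
      have h2 : fderiv ℝ (fun x => Q x - x) x = fderiv ℝ Q x - ContinuousLinearMap.id ℝ V :=
        (hx.hasFDerivAt.sub (hasFDerivAt_id x)).fderiv
      rw [h2]
      abel
    rw [h1]
    by_contra hdet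
    have hunit : IsUnit (fderiv ℝ Q x : V →ₗ[ℝ] V) :=
      LinearMap.isUnit_iff_isUnit_det _ |>.2 (isUnit_iff_ne_zero.2 hdet)
    obtain ⟨k, hk⟩ := ((Module.End.isUnit_iff _).1 hunit).2 (Q x)
    have hconst : (fun y => inner ℝ (Q y) (Q y)) =ᶠ[𝓝 x] fun _ => R ^ 2 := by
      filter_upwards [Metric.isOpen_ball.mem_nhds hxR] with y hy
      rw [real_inner_self_eq_norm_sq, hin y (by simpa using (Metric.mem_ball.1 hy).le)]
    have hd1 := (hx.hasFDerivAt.inner ℝ hx.hasFDerivAt).unique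
      ((hasFDerivAt_const (R ^ 2) x).congr_of_eventuallyEq hconst)
    have hd2 := DFunLike.congr_fun hd1 k
    have hk' : fderiv ℝ Q x k = Q x := hk
    simp [hk', fderivInnerCLM_apply, hin x (by simpa using (Metric.mem_ball.1 hxR).le)] at hd2
    exact hR.ne' hd2
  rw [integral_congr_ae hae] at hint
  have hpos : 0 < μ.real (Metric.ball 0 R) :=
    ENNReal.toReal_pos (Metric.measure_ball_pos μ _ hR).ne' Metric.isBounded_ball.measure_lt_top.ne
  simp [← hμ] at hint
  exact hpos.ne hint

/-- A Lipschitz map which is the identity outside a ball has a zero. -/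
lemma exists_eq_zero_of_lipschitzWith {P : V → V} {C : ℝ≥0} (hP : LipschitzWith C P) {r : ℝ}
    (hout : ∀ x, r ≤ ‖x‖ → P x = x) : ∃ x, P x = 0 := by
  by_contra! hne
  set R : ℝ := max r 0 + ‖P 0‖ + C * max r 0 + 1 with hRdef
  have hr0 : 0 ≤ max r 0 := le_max_right _ _
  have hCr : 0 ≤ C * max r 0 := by positivity
  have hrR : r ≤ R := by linarith [le_max_left r 0, norm_nonneg (P 0)]
  have hR : 0 < R := by linarith [norm_nonneg (P 0)]
  have hball : ∀ x, ‖x‖ ≤ R → ‖P x‖ ≤ R := by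
    intro x hx
    rcases le_total r ‖x‖ with h | h
    · rwa [hout x h]
    · have h1 := hP.norm_sub_le x 0
      have h2 : (C : ℝ) * ‖x - 0‖ ≤ C * max r 0 := by
        rw [sub_zero]
        gcongr
        exact h.trans (le_max_left _ _)
      linarith [norm_sub_norm_le (P x) (P 0)]
  obtain ⟨x₀, -, hx₀⟩ := (isCompact_closedBall (0 : V) R).exists_isMinOn
    ⟨0, by simpa using hR.le⟩ hP.continuous.norm.continuousOn
  set δ := min ‖P x₀‖ R with hδdef
  have hδ : 0 < δ := lt_min (norm_pos_iff.2 (hne x₀)) hR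
  have hδP : ∀ x, δ ≤ ‖P x‖ := by
    intro x
    rcases le_total ‖x‖ R with h | h
    · exact (min_le_left _ _).trans (hx₀ (by simpa using h))
    · rw [hout x (hrR.trans h)]
      exact (min_le_right _ _).trans h
  refine not_norm_eq_of_lipschitzWith
    (Q := fun x => P x + max (R - ‖P x‖) 0 • (‖P x‖⁻¹ • P x))
    (C := (2 + R * (2 / δ)).toNNReal * C) ?_ hR ?_ ?_
  · refine LipschitzWith.of_dist_le_mul fun x y => ?_
    rw [dist_eq_norm, dist_eq_norm, NNReal.coe_mul, Real.coe_toNNReal _ (by positivity), mul_assoc]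
    exact (norm_radial_sub_le hδ hR.le (hδP x) (hδP y)).trans
      (mul_le_mul_of_nonneg_left (hP.norm_sub_le x y) (by positivity))
  · intro x hx
    have : P x = x := hout x (hrR.trans hx)
    simp [this, max_eq_right (sub_nonpos.2 hx)]
  · intro x hx
    have h0 : 0 < ‖P x‖ := norm_pos_iff.2 (hne x)
    have h1 : P x + max (R - ‖P x‖) 0 • (‖P x‖⁻¹ • P x) = (R * ‖P x‖⁻¹) • P x := by
      rw [max_eq_left (sub_nonneg.2 (hball x hx)), smul_smul]
      nth_rewrite 1 [← one_smul ℝ (P x)]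
      rw [← add_smul]
      congr 1
      field_simp
      ring
    simp only [h1]
    rw [norm_smul, Real.norm_of_nonneg (by positivity), mul_assoc, inv_mul_cancel₀ h0.ne', mul_one]

/-- A map which is Lipschitz on a ball of radius `r + 1` and satisfies `0 < ⟪P x, x⟫` for
`r < ‖x‖` has a zero. -/
lemma exists_eq_zero_of_inner_pos {P : V → V} {r : ℝ} (hr : 0 ≤ r) {K : ℝ≥0}
    (hP : LipschitzOnWith K P (Metric.closedBall 0 (r + 1)))
    (hpos : ∀ x, r < ‖x‖ → 0 < inner ℝ (P x) x) : ∃ x, P x = 0 := by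
  set φ : V → ℝ := fun x => max (min 1 (r + 1 - ‖x‖)) 0 with hφ
  have hφ0 : ∀ x, 0 ≤ φ x := fun x => le_max_right _ _
  have hφ1 : ∀ x, φ x ≤ 1 := fun x => max_le (min_le_left _ _) zero_le_one
  have hφout : ∀ x, r + 1 ≤ ‖x‖ → φ x = 0 := fun x hx =>
    max_eq_right ((min_le_right _ _).trans (by linarith))
  have hφin : ∀ x, ‖x‖ ≤ r → φ x = 1 := fun x hx => by
    simp only [hφ]
    rw [min_eq_left (by linarith), max_eq_left zero_le_one]
  have hφLip : ∀ x y, |φ x - φ y| ≤ ‖x - y‖ := fun x y => by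
    refine (abs_max_sub_max_le_abs _ _ _).trans ((abs_min_sub_min_le_max _ _ _ _).trans ?_)
    rw [sub_self, abs_zero, max_eq_right (abs_nonneg _),
      show r + 1 - ‖x‖ - (r + 1 - ‖y‖) = ‖y‖ - ‖x‖ by ring, norm_sub_rev]
    exact abs_norm_sub_norm_le y x
  set G : V → V := fun x => P x - x with hG
  have hGLip : ∀ x y, ‖x‖ ≤ r + 1 → ‖y‖ ≤ r + 1 → ‖G x - G y‖ ≤ (K + 1) * ‖x - y‖ :=
    fun x y hx hy => by
      have h1 := hP.norm_sub_le (x := x) (y := y) (by simpa using hx) (by simpa using hy)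
      have h2 : G x - G y = (P x - P y) - (x - y) := by simp only [hG]; abel
      rw [h2]
      linarith [norm_sub_le (P x - P y) (x - y)]
  set B : ℝ := ‖G 0‖ + (K + 1) * (r + 1) with hB
  have hB0 : 0 ≤ B := by positivity
  have hGB : ∀ x, ‖x‖ ≤ r + 1 → ‖G x‖ ≤ B := fun x hx => by
    have h1 := hGLip x 0 hx (by simpa using by linarith)
    have h2 : ((K : ℝ) + 1) * ‖x - 0‖ ≤ (K + 1) * (r + 1) := by
      rw [sub_zero]; gcongr
    linarith [norm_sub_norm_le (G x) (G 0)]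
  have hcut : ∀ x y, ‖y‖ ≤ r + 1 →
      ‖φ x • G x - φ y • G y‖ ≤ (K + 1 + B) * ‖x - y‖ := fun x y hy => by
    rcases le_total ‖x‖ (r + 1) with hx | hx
    · have h1 : φ x • G x - φ y • G y = φ x • (G x - G y) + (φ x - φ y) • G y := by
        module
      have h2 : ‖φ x • (G x - G y)‖ ≤ 1 * ((K + 1) * ‖x - y‖) := by
        rw [norm_smul, Real.norm_of_nonneg (hφ0 x)]
        exact mul_le_mul (hφ1 x) (hGLip x y hx hy) (norm_nonneg _) zero_le_one
      have h3 : ‖(φ x - φ y) • G y‖ ≤ ‖x - y‖ * B := by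
        rw [norm_smul]
        exact mul_le_mul (hφLip x y) (hGB y hy) (norm_nonneg _) (norm_nonneg _)
      rw [h1]
      linarith [norm_add_le (φ x • (G x - G y)) ((φ x - φ y) • G y)]
    · have h1 : φ x • G x - φ y • G y = (φ x - φ y) • G y := by
        simp [hφout x hx]
      have h3 : ‖(φ x - φ y) • G y‖ ≤ ‖x - y‖ * B := by
        rw [norm_smul]
        exact mul_le_mul (hφLip x y) (hGB y hy) (norm_nonneg _) (norm_nonneg _)
      rw [h1]
      nlinarith [norm_nonneg (x - y), K.coe_nonneg, mul_nonneg K.coe_nonneg (norm_nonneg (x - y))]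
  have hcutLip : LipschitzWith (K + 1 + B.toNNReal) fun x => φ x • G x := by
    refine LipschitzWith.of_dist_le_mul fun x y => ?_
    rw [dist_eq_norm, dist_eq_norm]
    push_cast
    rw [Real.coe_toNNReal B hB0]
    rcases le_total ‖y‖ (r + 1) with hy | hy
    · exact hcut x y hy
    rcases le_total ‖x‖ (r + 1) with hx | hx
    · rw [norm_sub_rev, norm_sub_rev x y]
      exact hcut y x hx
    · simp only [hφout x hx, hφout y hy, zero_smul, sub_zero, norm_zero]
      positivity
  obtain ⟨x, hx⟩ := exists_eq_zero_of_lipschitzWith (LipschitzWith.id.add hcutLip) (r := r + 1)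
    fun x hx => by simp [hφout x hx]
  have hx' : x + φ x • (P x - x) = 0 := hx
  refine ⟨x, ?_⟩
  rcases le_or_gt ‖x‖ r with h | h
  · simpa [hφin x h] using hx'
  · exfalso
    have h1 := congrArg (fun z => inner ℝ z x) hx'
    simp only [inner_add_left, inner_smul_left, inner_sub_left, inner_zero_left,
      real_inner_self_eq_norm_sq, RCLike.conj_to_real] at h1
    have h2 := hpos x h
    have h3 : 0 < ‖x‖ ^ 2 := by
      have := hr.trans_lt h
      positivity
    rcases (hφ0 x).eq_or_lt with h0 | h0
    · rw [← h0] at h1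
      linarith
    · nlinarith [mul_pos h0 h2, mul_nonneg (sub_nonneg.2 (hφ1 x)) h3.le]

end Zeros


/-- Abstract content of Theorem 4.1: existence of solutions to the nonlinear
dynamic diffusion scheme, together with the stability bound. -/
theorem existence_of_discrete_solution {V : Type*} [NormedAddCommGroup V]
    [InnerProductSpace ℝ V] [FiniteDimensional ℝ V]
    (a : V → V → V → ℝ)
    (hlin₁ : ∀ w v : V, IsLinearMap ℝ fun u => a w u v)
    (hlin₂ : ∀ w u : V, IsLinearMap ℝ fun v => a w u v)
    (hcoer : ∀ w v : V, ‖v‖ ^ 2 ≤ a w v v)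
    (M L : ℝ) (hM : 0 ≤ M) (hL : 0 ≤ L)
    (hbdd : ∀ w u v : V, |a w u v| ≤ M * ‖u‖ * ‖v‖)
    (hlip : ∀ w w' u v : V, |a w u v - a w' u v| ≤ L * ‖w - w'‖ * ‖u‖ * ‖v‖)
    (F : V →L[ℝ] ℝ) :
    (∃ u : V, ∀ v : V, a u u v = F v) ∧
    (∀ u : V, (∀ v : V, a u u v = F v) → ‖u‖ ≤ ‖F‖) := by
  refine ⟨?_, fun u hu => ?_⟩
  · have hrep : ∀ w, ∃ z : V, ∀ v, inner ℝ z v = a w w v - F v := fun w => by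
      let ℓ : V →L[ℝ] ℝ := LinearMap.toContinuousLinearMap (hlin₂ w w).mk' - F
      exact ⟨(InnerProductSpace.toDual ℝ V).symm ℓ, fun v => by
        rw [InnerProductSpace.toDual_symm_apply]
        rfl⟩
    choose P hP using hrep
    have hK : 0 ≤ L * (‖F‖ + 1) + M := by positivity
    have hLip : LipschitzOnWith (L * (‖F‖ + 1) + M).toNNReal P
        (Metric.closedBall 0 (‖F‖ + 1)) := by
      refine LipschitzOnWith.of_dist_le_mul fun x hx y _ => ?_
      rw [dist_eq_norm, dist_eq_norm, Real.coe_toNNReal _ hK]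
      have hx' : ‖x‖ ≤ ‖F‖ + 1 := by simpa using hx
      set z := P x - P y with hz
      have h1 : ‖z‖ ^ 2 = (a x x z - a y x z) + a y (x - y) z := by
        have h2 : a y (x - y) z = a y x z - a y y z := (hlin₁ y z).map_sub x y
        rw [← real_inner_self_eq_norm_sq, h2]
        nth_rewrite 1 [hz]
        rw [inner_sub_left, hP, hP]
        ring
      have h2 := (le_abs_self _).trans (hlip x y x z)
      have h3 := (le_abs_self _).trans (hbdd y (x - y) z)
      have h4 : L * ‖x - y‖ * ‖x‖ * ‖z‖ ≤ L * ‖x - y‖ * (‖F‖ + 1) * ‖z‖ := by gcongr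
      rcases (norm_nonneg z).eq_or_lt with h0 | h0
      · rw [← h0]
        positivity
      · refine le_of_mul_le_mul_right ?_ h0
        linarith
    have hpos : ∀ x, ‖F‖ < ‖x‖ → 0 < inner ℝ (P x) x := fun x hx => by
      rw [hP]
      have h1 := hcoer x x
      have h2 := (le_abs_self _).trans (F.le_opNorm x)
      nlinarith [(norm_nonneg F).trans_lt hx]
    obtain ⟨u, hu⟩ := exists_eq_zero_of_inner_pos (norm_nonneg F) hLip hpos
    exact ⟨u, fun v => sub_eq_zero.1 (by rw [← hP u v, hu, inner_zero_left])⟩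
  · have h1 := hcoer u u
    rw [hu u] at h1
    have h2 := (le_abs_self _).trans (F.le_opNorm u)
    rcases (norm_nonneg u).eq_or_lt with h0 | h0
    · rw [← h0]
      exact norm_nonneg F
    · refine le_of_mul_le_mul_right ?_ h0
      linarith
end

section
/- Let V be a real inner product space with norm ‖·‖, and let a : V × V × V → ℝ be such that for every w ∈ V the map (u,v) ↦ a(w;u,v) is bilinear. Assume: (i) a(w;v,v) ≥ ‖v‖² for all w, v ∈ V; (ii) there is a constant L ≥ 0 with |a(w;u,v) − a(w′;u,v)| ≤ L‖w − w′‖‖u‖‖v‖ for all w, w′, u, v ∈ V. Let F : V → ℝ be a continuous linear functional with L‖F‖ < 1 (operator norm). Then there is at most one u ∈ V satisfying a(u;u,v) = F(v) for all v ∈ V. -/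
/-- Abstract content of Theorem 4.2: uniqueness of the discrete solution under
the smallness condition `L * ‖F‖ < 1`. -/
theorem uniqueness_of_discrete_solution {V : Type*} [NormedAddCommGroup V]
    [InnerProductSpace ℝ V]
    (a : V → V → V → ℝ)
    (hlin₁ : ∀ w v : V, IsLinearMap ℝ fun u => a w u v)
    (hlin₂ : ∀ w u : V, IsLinearMap ℝ fun v => a w u v)
    (hcoer : ∀ w v : V, ‖v‖ ^ 2 ≤ a w v v)
    (L : ℝ) (hL : 0 ≤ L)
    (hlip : ∀ w w' u v : V, |a w u v - a w' u v| ≤ L * ‖w - w'‖ * ‖u‖ * ‖v‖)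
    (F : V →L[ℝ] ℝ) (hsmall : L * ‖F‖ < 1) :
    ∀ u₁ u₂ : V, (∀ v : V, a u₁ u₁ v = F v) → (∀ v : V, a u₂ u₂ v = F v) → u₁ = u₂ := by
  intro u₁ u₂ h₁ h₂
  have hbound : ‖u₂‖ ≤ ‖F‖ := by
    have h : ‖u₂‖ * ‖u₂‖ ≤ ‖F‖ * ‖u₂‖ :=
      calc ‖u₂‖ * ‖u₂‖ = ‖u₂‖ ^ 2 := (sq _).symm
        _ ≤ F u₂ := h₂ u₂ ▸ hcoer u₂ u₂
        _ ≤ ‖F‖ * ‖u₂‖ := (le_abs_self _).trans (F.le_opNorm u₂)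
    by_contra! hlt
    exact hlt.not_ge (le_of_mul_le_mul_right h ((norm_nonneg F).trans_lt hlt))
  have hdiff : ‖u₁ - u₂‖ ^ 2 ≤ L * ‖F‖ * ‖u₁ - u₂‖ ^ 2 :=
    calc ‖u₁ - u₂‖ ^ 2 ≤ a u₁ (u₁ - u₂) (u₁ - u₂) := hcoer _ _
      _ = a u₁ u₁ (u₁ - u₂) - a u₁ u₂ (u₁ - u₂) := (hlin₁ u₁ (u₁ - u₂)).map_sub u₁ u₂
      _ = a u₂ u₂ (u₁ - u₂) - a u₁ u₂ (u₁ - u₂) := by rw [h₁, h₂]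
      _ ≤ L * ‖u₂ - u₁‖ * ‖u₂‖ * ‖u₁ - u₂‖ := (le_abs_self _).trans (hlip _ _ _ _)
      _ = L * ‖u₂‖ * ‖u₁ - u₂‖ ^ 2 := by rw [norm_sub_rev u₂ u₁]; ring
      _ ≤ L * ‖F‖ * ‖u₁ - u₂‖ ^ 2 := by gcongr
  by_contra hne
  have hpos : 0 < ‖u₁ - u₂‖ ^ 2 := pow_pos (norm_pos_iff.mpr (sub_ne_zero.mpr hne)) 2
  exact ((mul_lt_iff_lt_one_left hpos).mpr hsmall).not_ge hdiff
end
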